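/- arXiv:1904.04044 — 3 statements merged into one kernel-verified Lean document; each statement's English description precedes it below -/
import Mathlib

section
/- Normal Form Theorem (existence): Every persistence module (V,π) over 𝔽 is isomorphic, as a persistence module, to a finite direct sum ⊕_{i=1}^N 𝔽(I_i)^{m_i}, where the I_i are pairwise distinct intervals, each of the form (a_i,b_i] with a_i ∈ ℝ, b_i ∈ ℝ ∪ {+∞}, a_i < b_i, and m_i ∈ ℕ are positive multiplicities. -/
open Classical

noncomputable section

/-- A persistence module over a field `𝔽`: a family of finite-dimensional vector
spaces indexed by `ℝ` together with transition maps satisfying the persistence laws. -/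
structure PersistenceModule (𝔽 : Type) [Field 𝔽] where
  V : ℝ → Type
  [grp : ∀ t, AddCommGroup (V t)]
  [mod : ∀ t, Module 𝔽 (V t)]
  [fin : ∀ t, FiniteDimensional 𝔽 (V t)]
  π : ∀ s t : ℝ, s ≤ t → (V s →ₗ[𝔽] V t)
  π_refl : ∀ t : ℝ, π t t le_rfl = LinearMap.id
  π_comp : ∀ (s t r : ℝ) (hst : s ≤ t) (htr : t ≤ r),
    (π t r htr).comp (π s t hst) = π s r (hst.trans htr)

attribute [instance] PersistenceModule.grp PersistenceModule.mod PersistenceModule.fin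

namespace PersistenceModule

variable {𝔽 : Type} [Field 𝔽]

/-- The regularity ("finite type", semicontinuity and lower-boundedness) axioms of a
persistence module: away from a finite set, transition maps are locally isomorphisms;
the module is semicontinuous from the left; and it vanishes for `s` sufficiently small. -/
def IsRegular (M : PersistenceModule 𝔽) : Prop :=
  (∃ S : Finset ℝ, ∀ t : ℝ, t ∉ S → ∃ U ∈ nhds t,
    ∀ s ∈ U, ∀ r ∈ U, ∀ h : s ≤ r, Function.Bijective (M.π s r h)) ∧
  (∀ t : ℝ, ∃ ε : ℝ, 0 < ε ∧ ∀ s : ℝ, t - ε < s → ∀ h : s ≤ t, Function.Bijective (M.π s t h)) ∧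
  (∃ s₀ : ℝ, ∀ s : ℝ, s ≤ s₀ → ∀ x : M.V s, x = 0)

/-- A morphism of persistence modules. -/
structure Hom (M N : PersistenceModule 𝔽) where
  A : ∀ t : ℝ, M.V t →ₗ[𝔽] N.V t
  comm : ∀ (s t : ℝ) (h : s ≤ t), (A t).comp (M.π s t h) = (N.π s t h).comp (A s)

/-- Two persistence modules are isomorphic if there are mutually inverse morphisms. -/
def Iso (M N : PersistenceModule 𝔽) : Prop :=
  ∃ (f : Hom M N) (g : Hom N M),
    (∀ (t : ℝ) (x : M.V t), g.A t (f.A t x) = x) ∧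
    (∀ (t : ℝ) (y : N.V t), f.A t (g.A t y) = y)

/-- `δ`-interleaving of two persistence modules, stated pointwise (`F, G` are the
interleaving morphisms `V → W[δ]`, `W → V[δ]`, and the two triangles express that the
compositions are the `2δ`-shift morphisms). -/
def Interleaved (M N : PersistenceModule 𝔽) (δ : ℝ) : Prop :=
  ∃ (F : ∀ t : ℝ, M.V t →ₗ[𝔽] N.V (t + δ)) (G : ∀ t : ℝ, N.V t →ₗ[𝔽] M.V (t + δ)),
    (∀ (s t : ℝ) (h : s ≤ t),
      (F t).comp (M.π s t h) = (N.π (s + δ) (t + δ) (by linarith)).comp (F s)) ∧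
    (∀ (s t : ℝ) (h : s ≤ t),
      (G t).comp (N.π s t h) = (M.π (s + δ) (t + δ) (by linarith)).comp (G s)) ∧
    (∀ (t : ℝ) (h : t ≤ t + δ + δ),
      (G (t + δ)).comp (F t) = M.π t (t + δ + δ) h) ∧
    (∀ (t : ℝ) (h : t ≤ t + δ + δ),
      (F (t + δ)).comp (G t) = N.π t (t + δ + δ) h)

/-- Interleaving distance, with value in `EReal` (`+∞` if no interleaving exists). -/
def dInt (M N : PersistenceModule 𝔽) : EReal :=
  sInf {x : EReal | ∃ δ : ℝ, 0 < δ ∧ x = (δ : EReal) ∧ Interleaved M N δ}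

/-- The persistence submodule of `(-1)`-eigenspaces of an endomorphism `A` of `M`. -/
def negEigen (M : PersistenceModule 𝔽) (A : Hom M M) : PersistenceModule 𝔽 where
  V t := ↥(LinearMap.ker (A.A t + (LinearMap.id : M.V t →ₗ[𝔽] M.V t)))
  π s t h := LinearMap.restrict (M.π s t h) (by
    intro x hx
    have hc := congrArg (fun f : M.V s →ₗ[𝔽] M.V t => f x) (A.comm s t h)
    simp only [LinearMap.comp_apply] at hc
    simp only [LinearMap.mem_ker, LinearMap.add_apply, LinearMap.id_apply] at hx ⊢
    rw [hc, ← map_add (M.π s t h), hx, map_zero])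
  π_refl t := by
    apply LinearMap.ext
    intro x
    apply Subtype.ext
    have := congrArg (fun f : M.V t →ₗ[𝔽] M.V t => f (x : M.V t)) (M.π_refl t)
    simpa [LinearMap.restrict_apply] using this
  π_comp s t r hst htr := by
    apply LinearMap.ext
    intro x
    apply Subtype.ext
    have := congrArg (fun f : M.V s →ₗ[𝔽] M.V r => f (x : M.V s)) (M.π_comp s t r hst htr)
    simpa [LinearMap.restrict_apply] using this

/-- `(δ, ℤ₂)`-equivariant interleaving of two persistence modules with involutions
`AM` and `AN`. -/
def Z2Interleaved (M N : PersistenceModule 𝔽) (AM : Hom M M) (AN : Hom N N) (δ : ℝ) : Prop :=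
  ∃ (F : ∀ t : ℝ, M.V t →ₗ[𝔽] N.V (t + δ)) (G : ∀ t : ℝ, N.V t →ₗ[𝔽] M.V (t + δ)),
    (∀ (s t : ℝ) (h : s ≤ t),
      (F t).comp (M.π s t h) = (N.π (s + δ) (t + δ) (by linarith)).comp (F s)) ∧
    (∀ (s t : ℝ) (h : s ≤ t),
      (G t).comp (N.π s t h) = (M.π (s + δ) (t + δ) (by linarith)).comp (G s)) ∧
    (∀ (t : ℝ) (h : t ≤ t + δ + δ),
      (G (t + δ)).comp (F t) = M.π t (t + δ + δ) h) ∧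
    (∀ (t : ℝ) (h : t ≤ t + δ + δ),
      (F (t + δ)).comp (G t) = N.π t (t + δ + δ) h) ∧
    (∀ t : ℝ, (F t).comp (AM.A t) = (AN.A (t + δ)).comp (F t)) ∧
    (∀ t : ℝ, (G t).comp (AN.A t) = (AM.A (t + δ)).comp (G t))

/-- The `ℤ₂`-interleaving distance, with value in `EReal`. -/
def dZ2Int (M N : PersistenceModule 𝔽) (AM : Hom M M) (AN : Hom N N) : EReal :=
  sInf {x : EReal | ∃ δ : ℝ, 0 < δ ∧ x = (δ : EReal) ∧ Z2Interleaved M N AM AN δ}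

end PersistenceModule

/-- A bar `(a, b]` is recorded as the pair of its left endpoint `a ∈ ℝ`
and its right endpoint `b ∈ ℝ ∪ {±∞}`. -/
abbrev Bar := ℝ × EReal

/-- A bar is valid if `a < b` (so it encodes a nonempty interval `(a,b]`, `b ≤ +∞`). -/
def Bar.valid (I : Bar) : Prop := (I.1 : EReal) < I.2

/-- Membership `t ∈ (a, b]`. -/
def Bar.has (I : Bar) (t : ℝ) : Prop := I.1 < t ∧ (t : EReal) ≤ I.2

/-- The fiber at `t` of the interval module of `I`, as a submodule of `𝔽`. -/
def barSub (𝔽 : Type) [Field 𝔽] (I : Bar) (t : ℝ) : Submodule 𝔽 𝔽 :=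
  if Bar.has I t then ⊤ else ⊥

lemma barSub_coe_zero {𝔽 : Type} [Field 𝔽] {I : Bar} {t : ℝ}
    (hm : ¬ Bar.has I t) (x : barSub 𝔽 I t) : (x : 𝔽) = 0 := by
  have hx := x.2
  simp only [barSub, if_neg hm, Submodule.mem_bot] at hx
  exact hx

/-- The transition maps of an interval module. -/
def barMap (𝔽 : Type) [Field 𝔽] (I : Bar) (s t : ℝ) :
    barSub 𝔽 I s →ₗ[𝔽] barSub 𝔽 I t where
  toFun x := ⟨if Bar.has I t then (x : 𝔽) else 0, by
    split_ifs with hm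
    · simp [barSub, hm]
    · exact (barSub 𝔽 I t).zero_mem⟩
  map_add' x y := by
    apply Subtype.ext
    by_cases hm : Bar.has I t <;> simp [hm]
  map_smul' c x := by
    apply Subtype.ext
    by_cases hm : Bar.has I t <;> simp [hm]

lemma barMap_coe (𝔽 : Type) [Field 𝔽] (I : Bar) (s t : ℝ) (x : barSub 𝔽 I s) :
    (barMap 𝔽 I s t x : 𝔽) = if Bar.has I t then (x : 𝔽) else 0 := rfl

lemma barMap_refl {𝔽 : Type} [Field 𝔽] {I : Bar} {t : ℝ} (x : barSub 𝔽 I t) :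
    barMap 𝔽 I t t x = x := by
  apply Subtype.ext
  rw [barMap_coe]
  split_ifs with hm
  · rfl
  · exact (barSub_coe_zero hm x).symm

lemma barMap_comp {𝔽 : Type} [Field 𝔽] {I : Bar} {s t r : ℝ} (hst : s ≤ t) (htr : t ≤ r)
    (x : barSub 𝔽 I s) :
    barMap 𝔽 I t r (barMap 𝔽 I s t x) = barMap 𝔽 I s r x := by
  apply Subtype.ext
  rw [barMap_coe, barMap_coe, barMap_coe]
  by_cases hr : Bar.has I r
  · by_cases ht : Bar.has I t
    · simp [hr, ht]
    · have ht2 : (t : EReal) ≤ I.2 := le_trans (by exact_mod_cast htr) hr.2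
      have ht1 : ¬ I.1 < t := fun h => ht ⟨h, ht2⟩
      have hs1 : ¬ Bar.has I s := fun hs => ht1 (lt_of_lt_of_le hs.1 hst)
      rw [barSub_coe_zero hs1 x]
      simp
  · simp [hr]

/-- The interval persistence module `𝔽(a,b]`. -/
def intervalModule (𝔽 : Type) [Field 𝔽] (I : Bar) : PersistenceModule 𝔽 where
  V t := ↥(barSub 𝔽 I t)
  π s t _ := barMap 𝔽 I s t
  π_refl t := LinearMap.ext fun x => barMap_refl x
  π_comp _ _ _ hst htr := LinearMap.ext fun x => barMap_comp hst htr x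

/-- The direct sum `⊕_{I ∈ B} 𝔽(I)` of the interval modules of the bars of a
barcode `B` (a finite multiset of bars), taken pointwise in `t`. -/
def barcodeModule (𝔽 : Type) [Field 𝔽] (B : Multiset Bar) : PersistenceModule 𝔽 where
  V t := ∀ i : Fin B.toList.length, ↥(barSub 𝔽 (B.toList.get i) t)
  π s t _ := LinearMap.pi fun i => (barMap 𝔽 (B.toList.get i) s t).comp (LinearMap.proj i)
  π_refl t := by
    apply LinearMap.ext
    intro x
    funext i
    simpa using barMap_refl (x i)
  π_comp s t r hst htr := by
    apply LinearMap.ext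
    intro x
    funext i
    simpa using barMap_comp hst htr (x i)

/-- `Multiset.filter` with classical decidability. -/
def cfilter {α : Type} (p : α → Prop) (s : Multiset α) : Multiset α :=
  @Multiset.filter α p (Classical.decPred p) s

/-- A bar of length `> 2δ`. -/
def BarLong (δ : ℝ) (I : Bar) : Prop := ((2 * δ : ℝ) : EReal) < I.2 - (I.1 : EReal)

/-- Two bars matched within error `δ`: left endpoints within `δ` of each other, and
either both right endpoints equal `+∞`, or both are finite and within `δ`. -/
def BarClose (δ : ℝ) (I J : Bar) : Prop :=
  |I.1 - J.1| ≤ δ ∧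
    ((I.2 = ⊤ ∧ J.2 = ⊤) ∨ (I.2 ≠ ⊤ ∧ J.2 ≠ ⊤ ∧ |EReal.toReal I.2 - EReal.toReal J.2| ≤ δ))

/-- A `δ`-matching between barcodes `B` and `C`, recorded as a multiset `m` of matched
pairs: it induces a partial bijection between a sub-multiset of `B` and a sub-multiset
of `C` which matches every bar of length `> 2δ` on both sides, and matched bars are
`δ`-close. -/
def IsMatching (δ : ℝ) (B C : Multiset Bar) (m : Multiset (Bar × Bar)) : Prop :=
  m.map Prod.fst ≤ B ∧ m.map Prod.snd ≤ C ∧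
  cfilter (BarLong δ) B ≤ m.map Prod.fst ∧
  cfilter (BarLong δ) C ≤ m.map Prod.snd ∧
  ∀ p ∈ m, BarClose δ p.1 p.2

/-- The bottleneck distance between two barcodes, with value in `EReal`. -/
def dBot (B C : Multiset Bar) : EReal :=
  sInf {x : EReal | ∃ δ : ℝ, 0 < δ ∧ x = (δ : EReal) ∧ ∃ m, IsMatching δ B C m}

/-- `m(B, (a,b])`: the number of bars of `B` (with multiplicity) containing `(a,b]`. -/
def multB (B : Multiset Bar) (a b : ℝ) : ℕ :=
  (cfilter (fun I : Bar => I.1 ≤ a ∧ (b : EReal) ≤ I.2) B).card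

/-- The multiplicity function `μ_k` of a barcode, with value in `EReal`
(it equals `0` if no suitable `c` exists). -/
def muk (k : ℕ) (B : Multiset Bar) : EReal :=
  sSup (insert (0 : EReal)
    {x : EReal | ∃ c : ℝ, 0 < c ∧ x = (c : EReal) ∧
      ∃ a b : ℝ, 4 * c < b - a ∧ multB B a b = k ∧ multB B (a + 2 * c) (b - 2 * c) = k})

/-- `μ_odd`: the supremum of `μ_k` over odd `k`. -/
def muOdd (B : Multiset Bar) : EReal :=
  sSup {x : EReal | ∃ k : ℕ, Odd k ∧ x = muk k B}

/-- `β_k`: the length of the `k`-th longest finite bar of a barcode (`0` if there are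
fewer than `k` finite bars). -/
def betak (k : ℕ) (B : Multiset Bar) : ℝ :=
  ((((cfilter (fun I : Bar => I.2 ≠ ⊤) B).map
      (fun I : Bar => EReal.toReal I.2 - I.1)).sort (· ≤ ·)).reverse).getD (k - 1) 0

end

/-- Two finite families with the same multiset of values differ by a bijection of the index
types. -/
lemma exists_equiv_of_map_univ_eq {α β γ : Type} [Fintype α] [Fintype β] {f : α → γ} {g : β → γ}
    (h : Finset.univ.val.map f = Finset.univ.val.map g) : ∃ e : α ≃ β, ∀ a, g (e a) = f a := by
  have hc : ∀ c, Nonempty ({a // f a = c} ≃ {b // g b = c}) := fun c => by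
    refine ⟨Fintype.equivOfCardEq ?_⟩
    have hcount := congrArg (Multiset.count c) h
    rw [Multiset.count_map, Multiset.count_map] at hcount
    rw [Fintype.card_subtype, Fintype.card_subtype]
    simpa only [Finset.card_def, Finset.filter_val, eq_comm] using hcount
  exact ⟨Equiv.ofFiberEquiv fun c => (hc c).some, fun a => Equiv.ofFiberEquiv_map _ a⟩

namespace PersistenceModule

variable {𝔽 : Type} [Field 𝔽]

lemma π_apply (M : PersistenceModule 𝔽) {s t r : ℝ} (hst : s ≤ t) (htr : t ≤ r) (x : M.V s) :
    M.π t r htr (M.π s t hst x) = M.π s r (hst.trans htr) x :=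
  LinearMap.congr_fun (M.π_comp s t r hst htr) x

lemma π_refl_apply (M : PersistenceModule 𝔽) {t : ℝ} (h : t ≤ t) (x : M.V t) :
    M.π t t h x = x :=
  LinearMap.congr_fun (M.π_refl t) x

lemma coe_π_apply (M : PersistenceModule 𝔽) {s t r : ℝ} (hst : s ≤ t) (htr : t ≤ r) :
    M.π t r htr ∘ M.π s t hst = M.π s r (hst.trans htr) :=
  funext (M.π_apply hst htr)

/-- A decomposition of `M` into finitely many interval modules, indexed by an arbitrary finite
type. -/
def Decomposes (M : PersistenceModule 𝔽) : Prop :=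
  ∃ (ι : Type) (_ : Fintype ι) (I : ι → Bar) (L : ∀ t, M.V t ≃ₗ[𝔽] ∀ i, barSub 𝔽 (I i) t),
    (∀ i, Bar.valid (I i)) ∧
    ∀ (s t : ℝ) (h : s ≤ t) (x : M.V s) (i : ι),
      L t (M.π s t h x) i = barMap 𝔽 (I i) s t (L s x i)

lemma Decomposes.exists_barcode {M : PersistenceModule 𝔽} (hM : M.Decomposes) :
    ∃ B : Multiset Bar, (∀ I ∈ B, Bar.valid I) ∧ Iso M (barcodeModule 𝔽 B) := by
  obtain ⟨ι, _, I, L, hI, hL⟩ := hM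
  obtain ⟨B, hB⟩ : ∃ B : Multiset Bar, B = Finset.univ.val.map I := ⟨_, rfl⟩
  have hmap : Finset.univ.val.map B.toList.get = Finset.univ.val.map I := by
    rw [← hB, Fin.univ_val_map, List.ofFn_get, Multiset.coe_toList]
  obtain ⟨e, he⟩ := exists_equiv_of_map_univ_eq hmap
  obtain rfl : I = fun j => B.toList.get (e.symm j) := by
    funext j
    rw [← he, e.apply_symm_apply]
  let K (t : ℝ) : (∀ j, barSub 𝔽 (B.toList.get (e.symm j)) t) ≃ₗ[𝔽] (barcodeModule 𝔽 B).V t :=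
    LinearEquiv.piCongrLeft 𝔽 (fun i => barSub 𝔽 (B.toList.get i) t) e.symm
  have hK : ∀ t y j, K t y (e.symm j) = y j := fun t y j =>
    Equiv.piCongrLeft_apply_apply (fun i => barSub 𝔽 (B.toList.get i) t) e.symm y j
  have hcomm : ∀ s t (h : s ≤ t) (x : M.V s),
      K t (L t (M.π s t h x)) = (barcodeModule 𝔽 B).π s t h (K s (L s x)) := by
    intro s t h x
    funext i
    obtain ⟨j, rfl⟩ := e.symm.surjective i
    rw [hK, hL]
    change _ = barMap 𝔽 _ s t (K s (L s x) (e.symm j))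
    rw [hK]
  refine ⟨B, ?_, ⟨fun t => (L t).trans (K t), fun s t h => LinearMap.ext (hcomm s t h)⟩,
    ⟨fun t => ((L t).trans (K t)).symm, fun s t h => LinearMap.ext fun y => ?_⟩,
    fun t x => ((L t).trans (K t)).symm_apply_apply x,
    fun t y => ((L t).trans (K t)).apply_symm_apply y⟩
  · intro J hJ
    rw [hB, Multiset.mem_map] at hJ
    obtain ⟨j, -, rfl⟩ := hJ
    exact hI j
  · obtain ⟨x, rfl⟩ := ((L s).trans (K s)).surjective y
    apply ((L t).trans (K t)).injective
    change ((L t).trans (K t)) (((L t).trans (K t)).symm _) =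
      ((L t).trans (K t)) (M.π s t h (((L s).trans (K s)).symm (((L s).trans (K s)) x)))
    rw [LinearEquiv.apply_symm_apply, LinearEquiv.symm_apply_apply]
    exact (hcomm s t h x).symm

/-- A splitting of the interval module of the bar `I` off `M`: the inclusion sends the generator
at time `t` to `u t`, and the retraction at time `t` is the functional `φ t`. -/
structure Splitting (M : PersistenceModule 𝔽) (I : Bar) where
  u : ∀ t, M.V t
  φ : ∀ t, M.V t →ₗ[𝔽] 𝔽
  u_eq_zero : ∀ t, ¬ I.has t → u t = 0
  φ_eq_zero : ∀ t, ¬ I.has t → φ t = 0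
  π_u : ∀ s t (h : s ≤ t), I.has s → M.π s t h (u s) = u t
  φ_π : ∀ s t (h : s ≤ t) (x : M.V s), I.has t → φ t (M.π s t h x) = φ s x
  φ_u : ∀ t, I.has t → φ t (u t) = 1

namespace Splitting

variable {M : PersistenceModule 𝔽} {I : Bar} (S : Splitting M I)

lemma φ_π_eq_ite {s t : ℝ} (h : s ≤ t) (x : M.V s) :
    S.φ t (M.π s t h x) = if I.has t then S.φ s x else 0 := by
  split_ifs with ht
  · exact S.φ_π s t h x ht
  · rw [S.φ_eq_zero t ht, LinearMap.zero_apply]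

lemma smul_π_u {s t : ℝ} (h : s ≤ t) (x : M.V s) :
    S.φ s x • M.π s t h (S.u s) = S.φ t (M.π s t h x) • S.u t := by
  by_cases hs : I.has s
  · rw [S.π_u s t h hs]
    by_cases ht : I.has t
    · rw [S.φ_π s t h x ht]
    · rw [S.u_eq_zero t ht, smul_zero, smul_zero]
  · rw [S.u_eq_zero s hs, map_zero, smul_zero, S.φ_π_eq_ite, S.φ_eq_zero s hs]
    simp

lemma φ_sub_smul (t : ℝ) (x : M.V t) : S.φ t (x - S.φ t x • S.u t) = 0 := by
  by_cases ht : I.has t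
  · rw [map_sub, map_smul, S.φ_u t ht, smul_eq_mul, mul_one, sub_self]
  · rw [S.φ_eq_zero t ht, LinearMap.zero_apply]

/-- The complement of the split interval module. -/
def complement : PersistenceModule 𝔽 where
  V t := LinearMap.ker (S.φ t)
  π s t h := (M.π s t h).restrict fun x hx => by
    rw [LinearMap.mem_ker] at hx ⊢
    rw [S.φ_π_eq_ite, hx, ite_self]
  π_refl t := LinearMap.ext fun x => Subtype.ext (M.π_refl_apply _ _)
  π_comp _ _ _ hst htr := LinearMap.ext fun x => Subtype.ext (M.π_apply hst htr _)

lemma coe_complement_π {s t : ℝ} (h : s ≤ t) (x : S.complement.V s) :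
    (S.complement.π s t h x).1 = M.π s t h x.1 := rfl

lemma complement_bijective {s t : ℝ} (h : s ≤ t) (hst : I.has s → I.has t)
    (hb : Function.Bijective (M.π s t h)) : Function.Bijective (S.complement.π s t h) := by
  refine ⟨fun x y hxy => Subtype.ext (hb.1 (congrArg Subtype.val hxy)), fun y => ?_⟩
  obtain ⟨x, hx⟩ := hb.2 y.1
  refine ⟨⟨x, ?_⟩, Subtype.ext hx⟩
  rw [LinearMap.mem_ker]
  by_cases hs : I.has s
  · rw [← S.φ_π s t h x (hst hs), hx]
    exact y.2
  · rw [S.φ_eq_zero s hs, LinearMap.zero_apply]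

/-- Projection of an element of `M` to the complement. -/
def proj (t : ℝ) : M.V t →ₗ[𝔽] S.complement.V t :=
  (LinearMap.id - (S.φ t).smulRight (S.u t)).codRestrict _ (S.φ_sub_smul t)

lemma coe_proj (t : ℝ) (x : M.V t) : (S.proj t x).1 = x - S.φ t x • S.u t := rfl

lemma proj_π {s t : ℝ} (h : s ≤ t) (x : M.V s) :
    S.proj t (M.π s t h x) = S.complement.π s t h (S.proj s x) := by
  apply Subtype.ext
  rw [coe_complement_π, coe_proj, coe_proj, map_sub, map_smul, S.smul_π_u]

/-- The projection of `M` to the split interval module. -/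
noncomputable def retraction (t : ℝ) : M.V t →ₗ[𝔽] barSub 𝔽 I t :=
  (S.φ t).codRestrict _ fun x => by
    by_cases ht : I.has t
    · simp [barSub, ht]
    · simp [S.φ_eq_zero t ht]

lemma coe_retraction (t : ℝ) (x : M.V t) : (S.retraction t x : 𝔽) = S.φ t x := rfl

lemma decomposes (hI : I.valid) (hK : S.complement.Decomposes) : M.Decomposes := by
  obtain ⟨ι, _, J, L, hJ, hL⟩ := hK
  let I' : Option ι → Bar := fun o => o.elim I J
  let P (t : ℝ) : M.V t →ₗ[𝔽] ∀ o, barSub 𝔽 (I' o) t := LinearMap.pi fun o =>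
    match o with
    | none => S.retraction t
    | some i => LinearMap.proj i ∘ₗ (L t).toLinearMap ∘ₗ S.proj t
  have hnone : ∀ t x, P t x none = S.retraction t x := fun _ _ => rfl
  have hsome : ∀ t x i, P t x (some i) = L t (S.proj t x) i := fun _ _ _ => rfl
  have hP : ∀ t, Function.Bijective (P t) := by
    intro t
    constructor
    · rw [← LinearMap.ker_eq_bot, LinearMap.ker_eq_bot']
      intro x hx
      have h0 : S.φ t x = 0 := by
        rw [← coe_retraction, ← hnone, hx]
        rfl
      have h1 : S.proj t x = 0 := by
        apply (L t).injective
        rw [map_zero]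
        funext i
        rw [← hsome, hx]
        rfl
      have h2 := S.coe_proj t x
      rw [h0, zero_smul, sub_zero, h1] at h2
      exact h2.symm
    · intro y
      let k := (L t).symm fun i => y (some i)
      let c : 𝔽 := (show barSub 𝔽 I t from y none).1
      have hφ : S.φ t (k.1 + c • S.u t) = c := by
        rw [map_add, LinearMap.mem_ker.1 k.2, zero_add, map_smul]
        by_cases ht : I.has t
        · rw [S.φ_u t ht, smul_eq_mul, mul_one]
        · rw [S.φ_eq_zero t ht, LinearMap.zero_apply, smul_zero]
          exact (barSub_coe_zero ht (y none)).symm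
      refine ⟨k.1 + c • S.u t, funext fun o => ?_⟩
      cases o with
      | none => exact Subtype.ext hφ
      | some i =>
        rw [hsome]
        have : S.proj t (k.1 + c • S.u t) = k := by
          apply Subtype.ext
          rw [coe_proj, hφ, add_sub_cancel_right]
        rw [this]
        exact congrFun ((L t).apply_symm_apply fun i => y (some i)) i
  refine ⟨Option ι, inferInstance, I', fun t => LinearEquiv.ofBijective (P t) (hP t), ?_, ?_⟩
  · rintro (_ | i)
    exacts [hI, hJ i]
  · intro s t h x o
    simp only [LinearEquiv.ofBijective_apply]
    cases o with
    | none =>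
      rw [hnone, hnone]
      apply Subtype.ext
      rw [coe_retraction]
      exact S.φ_π_eq_ite h x
    | some i =>
      rw [hsome, hsome, S.proj_π]
      exact hL s t h _ i

end Splitting

end PersistenceModule

/-- A function partitioning the line into finitely many pieces `(-∞,c₁], (c₁,c₂], …, (cₙ,∞)`,
numbered in increasing order. -/
structure IsLevelFunction (κ : ℝ → ℕ) : Prop where
  mono : Monotone κ
  bdd : ∃ N, ∀ t, κ t ≤ N
  exists_left : ∀ t, 0 < κ t → ∃ c, (∀ s ≤ c, κ s < κ t) ∧ ∀ s, c < s → s ≤ t → κ s = κ t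

lemma isLevelFunction_card (T : Finset ℝ) :
    IsLevelFunction fun t => (T.filter (· < t)).card where
  mono s t h := Finset.card_le_card fun u hu => by
    rw [Finset.mem_filter] at hu ⊢
    exact ⟨hu.1, hu.2.trans_le h⟩
  bdd := ⟨T.card, fun t => Finset.card_filter_le _ _⟩
  exists_left t ht := by
    have hne : (T.filter (· < t)).Nonempty := Finset.card_pos.1 ht
    have hmem := Finset.max'_mem _ hne
    refine ⟨(T.filter (· < t)).max' hne, fun s hs => Finset.card_lt_card ?_, fun s hs hst => ?_⟩
    · rw [Finset.ssubset_iff_of_subset]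
      · exact ⟨_, hmem, fun h => (Finset.mem_filter.1 h).2.not_ge hs⟩
      · intro u hu
        rw [Finset.mem_filter] at hu hmem ⊢
        exact ⟨hu.1, hu.2.trans (hs.trans_lt hmem.2)⟩
    · congr 1
      ext u
      simp only [Finset.mem_filter, and_congr_right_iff]
      refine fun hu => ⟨fun h => h.trans_le hst, fun h => lt_of_le_of_lt ?_ hs⟩
      exact Finset.le_max' _ _ (Finset.mem_filter.2 ⟨hu, h⟩)

namespace PersistenceModule

variable {𝔽 : Type} [Field 𝔽] {κ : ℝ → ℕ}

/-- `M` is constant on each piece of the partition given by `κ`, and vanishes on the first one. -/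
structure Adapted (M : PersistenceModule 𝔽) (κ : ℝ → ℕ) : Prop where
  bijective : ∀ s t (h : s ≤ t), κ s = κ t → Function.Bijective (M.π s t h)
  eq_zero : ∀ t, κ t = 0 → ∀ x : M.V t, x = 0

lemma bijective_of_disjoint {M : PersistenceModule 𝔽} {S : Finset ℝ}
    (hS : ∀ t : ℝ, t ∉ S → ∃ U ∈ nhds t,
      ∀ s ∈ U, ∀ r ∈ U, ∀ h : s ≤ r, Function.Bijective (M.π s r h))
    (hleft : ∀ t : ℝ, ∃ ε : ℝ, 0 < ε ∧ ∀ s : ℝ, t - ε < s → ∀ h : s ≤ t,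
      Function.Bijective (M.π s t h))
    {s t : ℝ} (h : s ≤ t) (hst : ∀ u ∈ S, s ≤ u → t ≤ u) : Function.Bijective (M.π s t h) := by
  let B (x : ℝ) : Prop := ∃ hx : s ≤ x, Function.Bijective (M.π s x hx)
  have key : ∀ x y (hx : s ≤ x) (hxy : x ≤ y), Function.Bijective (M.π x y hxy) → (B x ↔ B y) := by
    intro x y hx hxy hb
    have hcomp := M.coe_π_apply hx hxy
    refine ⟨fun ⟨_, h'⟩ => ⟨hx.trans hxy, ?_⟩, fun ⟨_, h'⟩ => ⟨hx, ?_⟩⟩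
    · rw [← hcomp]
      exact hb.comp h'
    · rw [← hcomp] at h'
      exact (Function.Bijective.of_comp_iff' hb _).1 h'
  have main : B s ↔ B t := by
    refine isPreconnected_Icc.induction₂ (s := Set.Icc s t) (fun x y => (B x ↔ B y)) ?_
      (fun _ _ _ _ _ _ h₁ h₂ => h₁.trans h₂) (fun _ _ _ _ h => h.symm)
      (Set.left_mem_Icc.2 h) (Set.right_mem_Icc.2 h)
    intro x hx
    have hl : ∀ᶠ y in nhdsWithin x (Set.Icc s t), y ≤ x → (B x ↔ B y) := by
      obtain ⟨ε, hε, hb⟩ := hleft x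
      filter_upwards [self_mem_nhdsWithin,
        mem_nhdsWithin_of_mem_nhds (Ioi_mem_nhds (sub_lt_self x hε))] with y hy hy' hyx
      exact (key y x hy.1 hyx (hb y hy' hyx)).symm
    have hr : ∀ᶠ y in nhdsWithin x (Set.Icc s t), x < y → (B x ↔ B y) := by
      by_cases hxS : x ∈ S
      · filter_upwards [self_mem_nhdsWithin] with y hy hxy
        exact absurd (hxy.trans_le hy.2) (hst x hxS hx.1).not_gt
      · obtain ⟨U, hU, hb⟩ := hS x hxS
        filter_upwards [mem_nhdsWithin_of_mem_nhds hU] with y hy hxy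
        exact key x y hx.1 hxy.le (hb x (mem_of_mem_nhds hU) y hy hxy.le)
    filter_upwards [hl, hr] with y h₁ h₂
    exact (le_or_gt y x).elim h₁ h₂
  have hs : B s := ⟨le_rfl, by rw [M.π_refl]; exact Function.bijective_id⟩
  exact (main.1 hs).2

lemma IsRegular.exists_adapted {M : PersistenceModule 𝔽} (hM : M.IsRegular) :
    ∃ κ, IsLevelFunction κ ∧ M.Adapted κ := by
  obtain ⟨⟨S, hS⟩, hleft, s₀, hs₀⟩ := hM
  have hb : ∀ s t (h : s ≤ t), (S.filter (· < s)).card = (S.filter (· < t)).card →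
      Function.Bijective (M.π s t h) := by
    intro s t h hst
    refine bijective_of_disjoint hS hleft h fun u hu hsu => ?_
    by_contra! hut
    have hsub : S.filter (· < s) ⊆ S.filter (· < t) := fun v hv => by
      rw [Finset.mem_filter] at hv ⊢
      exact ⟨hv.1, hv.2.trans_le h⟩
    have heq := Finset.eq_of_subset_of_card_le hsub hst.ge
    have hmem : u ∈ S.filter (· < t) := Finset.mem_filter.2 ⟨hu, hut⟩
    rw [← heq, Finset.mem_filter] at hmem
    exact hmem.2.not_ge hsu
  refine ⟨_, isLevelFunction_card S, hb, fun t ht x => ?_⟩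
  have hle := (isLevelFunction_card S).mono (min_le_left t s₀)
  obtain ⟨y, rfl⟩ := (hb _ t (min_le_left t s₀) (by lia)).2 x
  rw [hs₀ _ (min_le_right t s₀) y, map_zero]

/-- A nonzero vector of `M` at the earliest level where `M` does not vanish spans a direct
summand that is an interval module. -/
lemma Adapted.exists_splitting {M : PersistenceModule 𝔽} (hκ : IsLevelFunction κ)
    (hM : M.Adapted κ) {t₀ : ℝ} {x₀ : M.V t₀} (hx₀ : x₀ ≠ 0)
    (hmin : ∀ t, κ t < κ t₀ → ∀ x : M.V t, x = 0) :
    ∃ I : Bar, I.valid ∧ I.has t₀ ∧ (∀ s t, κ s = κ t → (I.has s ↔ I.has t)) ∧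
      Nonempty (Splitting M I) := by
  obtain ⟨a, ha₁, ha₂⟩ := hκ.exists_left t₀
    (Nat.pos_of_ne_zero fun h => hx₀ (hM.eq_zero t₀ h x₀))
  have hat₀ : a < t₀ := by
    by_contra! h
    exact (ha₁ t₀ h).false
  have hlt : ∀ t, a < t ↔ κ t₀ ≤ κ t := by
    intro t
    refine ⟨fun h => ?_, fun h => ?_⟩
    · rcases le_total t t₀ with h' | h'
      · exact (ha₂ t h h').ge
      · exact hκ.mono h'
    · by_contra! h'
      exact (ha₁ t h').not_ge h
  obtain ⟨b, hb⟩ : ∃ b : EReal, ∀ t (h : t₀ ≤ t), (t : EReal) ≤ b ↔ M.π t₀ t h x₀ ≠ 0 := by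
    by_cases hD : ∃ n t, ∃ h : t₀ ≤ t, M.π t₀ t h x₀ = 0 ∧ κ t = n
    · obtain ⟨t₁, h₁, hz, hn⟩ := Nat.find_spec hD
      have hne : κ t₀ ≠ κ t₁ := fun h =>
        hx₀ ((hM.bijective t₀ t₁ h₁ h).1 (hz.trans (map_zero _).symm))
      have hlt₁ : κ t₀ < κ t₁ := lt_of_le_of_ne (hκ.mono h₁) hne
      obtain ⟨b, hb₁, hb₂⟩ := hκ.exists_left t₁ (by lia)
      refine ⟨b, fun t h => ?_⟩
      rw [EReal.coe_le_coe_iff]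
      refine ⟨fun htb h0 => ?_, fun h0 => ?_⟩
      · have := Nat.find_min' hD ⟨t, h, h0, rfl⟩
        have := hb₁ t htb
        lia
      · by_contra! hbt
        apply h0
        rcases le_total t t₁ with h' | h'
        · apply (hM.bijective t t₁ h' (hb₂ t hbt h')).1
          rw [M.π_apply, hz, map_zero]
        · rw [← M.π_apply h₁ h', hz, map_zero]
    · refine ⟨⊤, fun t h => ⟨fun _ h0 => hD ⟨_, t, h, h0, rfl⟩, fun _ => le_top⟩⟩
  have hbt₀ : (t₀ : EReal) ≤ b := (hb t₀ le_rfl).2 (by rwa [M.π_refl_apply])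
  let I : Bar := (a, b)
  have hIt₀ : I.has t₀ := ⟨hat₀, hbt₀⟩
  have hI : ∀ s t, κ s = κ t → (I.has s ↔ I.has t) := by
    have : ∀ s t, s ≤ t → κ s = κ t → (I.has s ↔ I.has t) := by
      intro s t h hst
      refine and_congr (by rw [hlt, hlt, hst]) ⟨fun hs => ?_, fun ht =>
        (EReal.coe_le_coe_iff.2 h).trans ht⟩
      rcases le_total t t₀ with h' | h'
      · exact (EReal.coe_le_coe_iff.2 h').trans hbt₀
      · rw [hb t h']
        rcases le_total s t₀ with h'' | h''
        · have : κ t₀ = κ t := (hκ.mono h').antisymm (hst.symm.le.trans (hκ.mono h''))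
          intro h0
          exact hx₀ ((hM.bijective t₀ t h' this).1 (h0.trans (map_zero _).symm))
        · rw [hb s h''] at hs
          intro h0
          rw [← M.π_apply h'' h] at h0
          exact hs ((hM.bijective s t h hst).1 (h0.trans (map_zero _).symm))
    intro s t hst
    rcases le_total s t with h | h
    · exact this s t h hst
    · exact (this t s h hst.symm).symm
  obtain ⟨m, hm, hmt₀, hmax⟩ : ∃ m, I.has m ∧ t₀ ≤ m ∧ ∀ t, I.has t → κ t ≤ κ m := by
    obtain ⟨N, hN⟩ := hκ.bdd
    have hfin : (κ '' {t | I.has t}).Finite :=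
      (Set.finite_Iic N).subset (by rintro _ ⟨t, -, rfl⟩; exact hN t)
    obtain ⟨_, ⟨m, hm, rfl⟩, hmax⟩ :=
      Set.exists_max_image _ id hfin ⟨_, t₀, hIt₀, rfl⟩
    have hmax' : ∀ t, I.has t → κ t ≤ κ m := fun t ht => hmax _ ⟨t, ht, rfl⟩
    refine ⟨max m t₀, ?_, le_max_right _ _, fun t ht =>
      (hmax' t ht).trans (hκ.mono (le_max_left _ _))⟩
    rcases max_choice m t₀ with h | h <;> rw [h] <;> assumption
  obtain ⟨ψ, hψ⟩ := Module.Projective.exists_dual_eq_one 𝔽 ((hb m hmt₀).1 hm.2)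
  have hu : ∀ t, ∃ u : M.V t, (t ≤ a → u = 0) ∧
      (∀ h : t ≤ t₀, a < t → M.π t t₀ h u = x₀) ∧ ∀ h : t₀ ≤ t, u = M.π t₀ t h x₀ := by
    intro t
    by_cases hta : t ≤ a
    · exact ⟨0, fun _ => rfl, fun _ h => absurd hta h.not_ge,
        fun h => absurd (h.trans hta) hat₀.not_ge⟩
    rcases le_total t t₀ with h | h
    · obtain ⟨u, hu⟩ := (hM.bijective t t₀ h (ha₂ t (not_le.1 hta) h)).2 x₀
      refine ⟨u, fun h => absurd h hta, fun _ _ => hu, fun h' => ?_⟩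
      obtain rfl := h.antisymm h'
      rw [π_refl_apply] at hu ⊢
      exact hu
    · refine ⟨M.π t₀ t h x₀, fun h => absurd h hta, fun h' _ => ?_, fun _ => rfl⟩
      rw [M.π_apply, M.π_refl_apply]
  choose u hu₁ hu₂ hu₃ using hu
  have hφ : ∀ t, ∃ φ : M.V t →ₗ[𝔽] 𝔽, (¬ I.has t → φ = 0) ∧
      (∀ h : t ≤ m, I.has t → φ = ψ ∘ₗ M.π t m h) ∧
      ∀ h : m ≤ t, I.has t → φ ∘ₗ M.π m t h = ψ := by
    intro t
    by_cases ht : I.has t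
    swap
    · exact ⟨0, fun _ => rfl, fun _ h => absurd h ht, fun _ h => absurd h ht⟩
    rcases le_total t m with h | h
    · refine ⟨ψ ∘ₗ M.π t m h, fun h => absurd ht h, fun _ _ => rfl, fun h' _ => ?_⟩
      rw [LinearMap.comp_assoc, M.π_comp, M.π_refl, LinearMap.comp_id]
    · have hbij := hM.bijective m t h ((hκ.mono h).antisymm (hmax t ht))
      let e := LinearEquiv.ofBijective (M.π m t h) hbij
      have he : (ψ ∘ₗ e.symm.toLinearMap) ∘ₗ M.π m t h = ψ :=
        LinearMap.ext fun x => congrArg ψ (e.symm_apply_apply x)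
      refine ⟨ψ ∘ₗ e.symm.toLinearMap, fun h => absurd ht h, fun h' _ => ?_, fun _ _ => he⟩
      obtain rfl := h.antisymm h'
      rw [M.π_refl, LinearMap.comp_id] at he ⊢
      exact he
  choose φ hφ₁ hφ₂ hφ₃ using hφ
  have hπu : ∀ s t (h : s ≤ t), I.has s → M.π s t h (u s) = u t := by
    intro s t h hs
    rcases le_total t₀ s with h₁ | h₁
    · rw [hu₃ s h₁, hu₃ t (h₁.trans h), M.π_apply]
    rcases le_total t₀ t with h₂ | h₂
    · rw [hu₃ t h₂, ← hu₂ s h₁ hs.1, M.π_apply]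
    · apply (hM.bijective t t₀ h₂ (ha₂ t (hs.1.trans_le h) h₂)).1
      rw [M.π_apply, hu₂ s h₁ hs.1, hu₂ t h₂ (hs.1.trans_le h)]
  refine ⟨I, (EReal.coe_lt_coe_iff.2 hat₀).trans_le hbt₀, hIt₀, hI, ⟨u, φ, ?_, hφ₁, hπu, ?_, ?_⟩⟩
  · intro t ht
    by_cases hta : t ≤ a
    · exact hu₁ t hta
    have htb : ¬ (t : EReal) ≤ b := fun h => ht ⟨not_le.1 hta, h⟩
    have htt₀ : t₀ ≤ t := by
      by_contra! h
      exact htb ((EReal.coe_le_coe_iff.2 h.le).trans hbt₀)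
    rw [hu₃ t htt₀]
    by_contra h
    exact htb ((hb t htt₀).2 h)
  · intro s t h x ht
    by_cases hs : I.has s
    swap
    · have hsa : s ≤ a := by
        by_contra! h'
        exact hs ⟨h', (EReal.coe_le_coe_iff.2 h).trans ht.2⟩
      rw [hmin s (ha₁ s hsa) x, map_zero, map_zero, map_zero]
    rcases le_total t m with h₁ | h₁
    · rw [hφ₂ t h₁ ht, hφ₂ s (h.trans h₁) hs, LinearMap.comp_apply, M.π_apply,
        LinearMap.comp_apply]
    rcases le_total s m with h₂ | h₂
    · rw [hφ₂ s h₂ hs, ← hφ₃ t h₁ ht, LinearMap.comp_apply, LinearMap.comp_apply, M.π_apply]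
    · obtain ⟨y, rfl⟩ := (hM.bijective m s h₂ ((hκ.mono h₂).antisymm (hmax s hs))).2 x
      rw [M.π_apply, ← LinearMap.comp_apply, ← LinearMap.comp_apply, hφ₃ t h₁ ht, hφ₃ s h₂ hs]
  · intro t ht
    have hψu : ψ (u m) = 1 := by rw [hu₃ m hmt₀, hψ]
    rcases le_total t m with h | h
    · rw [hφ₂ t h ht, LinearMap.comp_apply, hπu t m h ht, hψu]
    · rw [← hπu m t h hm, ← LinearMap.comp_apply, hφ₃ t h ht, hψu]

lemma Adapted.decomposes {M : PersistenceModule 𝔽} (hκ : IsLevelFunction κ) (hM : M.Adapted κ) :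
    M.Decomposes := by
  obtain ⟨N, hN⟩ := hκ.bdd
  let ρ : ℕ → ℝ := Function.invFun κ
  have hρ : ∀ t, κ (ρ (κ t)) = κ t := fun t => Function.invFun_eq ⟨t, rfl⟩
  induction hn : ∑ k ∈ Finset.range (N + 1), Module.finrank 𝔽 (M.V (ρ k))
    using Nat.strong_induction_on generalizing M with
  | _ n ih =>
  by_cases hD : ∃ k t, ∃ x : M.V t, x ≠ 0 ∧ κ t = k
  · obtain ⟨t₁, x₁, hx₁, hk⟩ := Nat.find_spec hD
    obtain ⟨t₀, ht₀⟩ : ∃ t₀, t₀ = ρ (κ t₁) := ⟨_, rfl⟩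
    have hκt₀ : κ t₀ = κ t₁ := by rw [ht₀, hρ]
    obtain ⟨x₀, hx₀⟩ : ∃ x₀ : M.V t₀, x₀ ≠ 0 := by
      rcases le_total t₁ t₀ with h | h
      · exact ⟨M.π t₁ t₀ h x₁, fun h0 =>
          hx₁ ((hM.bijective t₁ t₀ h hκt₀.symm).1 (h0.trans (map_zero _).symm))⟩
      · obtain ⟨x₀, rfl⟩ := (hM.bijective t₀ t₁ h hκt₀).2 x₁
        exact ⟨x₀, fun h0 => hx₁ (by rw [h0, map_zero])⟩
    obtain ⟨I, hval, hIt₀, hI, ⟨S⟩⟩ := hM.exists_splitting hκ hx₀ fun t ht x => by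
      by_contra hx
      have := Nat.find_min' hD ⟨t, x, hx, rfl⟩
      lia
    refine S.decomposes hval (ih _ ?_ ⟨fun s t h hst => S.complement_bijective h (hI s t hst).1
      (hM.bijective s t h hst), fun t ht x => Subtype.ext (hM.eq_zero t ht _)⟩ rfl)
    rw [← hn]
    refine Finset.sum_lt_sum (fun k _ => Submodule.finrank_le _)
      ⟨κ t₁, Finset.mem_range.2 (Nat.lt_succ_of_le (hN t₁)), ?_⟩
    rw [← ht₀]
    refine Submodule.finrank_lt fun htop => one_ne_zero (α := 𝔽) ?_
    rw [← S.φ_u t₀ hIt₀, ← LinearMap.mem_ker, htop]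
    exact Submodule.mem_top
  · have hz : ∀ t, Subsingleton (M.V t) := fun t => subsingleton_of_forall_eq 0 fun x => by
      by_contra hx
      exact hD ⟨_, t, x, hx, rfl⟩
    exact ⟨Empty, inferInstance, Empty.elim, fun t => 0, fun i => i.elim, fun _ _ _ _ i => i.elim⟩

end PersistenceModule

/-- **Normal Form Theorem (existence).** Every persistence module is isomorphic to a
finite direct sum of interval modules `𝔽(a,b]` with `a < b ≤ +∞` (the multiset `B`
records the pairwise distinct intervals with their positive multiplicities). -/
theorem normal_form_existence {𝔽 : Type} [Field 𝔽] (M : PersistenceModule 𝔽)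
    (hM : M.IsRegular) :
    ∃ B : Multiset Bar, (∀ I ∈ B, Bar.valid I) ∧
      PersistenceModule.Iso M (barcodeModule 𝔽 B) := by
  obtain ⟨κ, hκ, hMκ⟩ := hM.exists_adapted
  exact (hMκ.decomposes hκ).exists_barcode
end

section
/- Normal Form Theorem (uniqueness): If B and C are finite multisets of intervals of the form (a,b] with −∞ < a < b ≤ +∞, and the persistence modules ⊕_{I∈B} 𝔽(I) and ⊕_{J∈C} 𝔽(J) are isomorphic, then B = C as multisets. -/
open Classical

namespace PersistenceModule

variable {𝔽 : Type} [Field 𝔽]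

/-- The structure maps of isomorphic persistence modules have the same ranks. -/
lemma Iso.finrank_range_eq {M N : PersistenceModule 𝔽} (h : Iso M N) {s t : ℝ} (hst : s ≤ t) :
    Module.finrank 𝔽 (LinearMap.range (M.π s t hst)) =
      Module.finrank 𝔽 (LinearMap.range (N.π s t hst)) := by
  obtain ⟨f, g, hgf, hfg⟩ := h
  have hmap : (LinearMap.range (M.π s t hst)).map (f.A t) = LinearMap.range (N.π s t hst) := by
    rw [← LinearMap.range_comp, f.comm]
    exact LinearMap.range_comp_of_range_eq_top _
      (LinearMap.range_eq_top.2 (Function.LeftInverse.surjective (hfg s)))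
  rw [← hmap]
  exact (LinearEquiv.finrank_eq (Submodule.equivMapOfInjective _
    (Function.LeftInverse.injective (hgf t)) _))

end PersistenceModule

lemma mem_barSub {𝔽 : Type} [Field 𝔽] {I : Bar} {t : ℝ} (h : Bar.has I t) (x : 𝔽) :
    x ∈ barSub 𝔽 I t := by
  simp [barSub, h]

lemma Bar.has_and_has_iff {I : Bar} {s t : ℝ} (hst : s ≤ t) :
    (Bar.has I s ∧ Bar.has I t) ↔ I.1 < s ∧ (t : EReal) ≤ I.2 :=
  ⟨fun h => ⟨h.1.1, h.2.2⟩, fun h =>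
    ⟨⟨h.1, (EReal.coe_le_coe_iff.2 hst).trans h.2⟩, h.1.trans_le hst, h.2⟩⟩

lemma List.card_subtype_get_eq_countP {α : Type*} (p : α → Prop) [DecidablePred p] (l : List α) :
    Fintype.card {i : Fin l.length // p (l.get i)} = l.countP (fun a => decide (p a)) := by
  rw [Fintype.card_subtype]
  conv_rhs => rw [← List.map_get_finRange l, List.countP_map, List.countP_eq_length_filter]
  rfl

/-- The rank of a structure map of a barcode module is the number of bars containing both
endpoints. -/
lemma finrank_range_barcodeModule (𝔽 : Type) [Field 𝔽] (B : Multiset Bar) {s t : ℝ}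
    (hst : s ≤ t) :
    Module.finrank 𝔽 (LinearMap.range ((barcodeModule 𝔽 B).π s t hst)) =
      B.countP (fun I : Bar => I.1 < s ∧ (t : EReal) ≤ I.2) := by
  let P : Fin B.toList.length → Prop := fun i =>
    (B.toList.get i).1 < s ∧ (t : EReal) ≤ (B.toList.get i).2
  have hP : ∀ i, P i → Bar.has (B.toList.get i) s ∧ Bar.has (B.toList.get i) t :=
    fun i => (Bar.has_and_has_iff hst).2
  let g : ({i // P i} → 𝔽) →ₗ[𝔽] (∀ i : Fin B.toList.length, barSub 𝔽 (B.toList.get i) t) :=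
    LinearMap.pi fun i => if h : P i then
      (LinearMap.proj ⟨i, h⟩ : ({i // P i} → 𝔽) →ₗ[𝔽] 𝔽).codRestrict _
        (fun _ => mem_barSub (hP i h).2 _) else 0
  have hg : ∀ x i, ((g x i : barSub 𝔽 (B.toList.get i) t) : 𝔽) =
      if h : P i then x ⟨i, h⟩ else 0 := by
    intro x i
    by_cases h : P i <;> simp [g, h]
  have hinj : Function.Injective g := by
    intro x y hxy
    ext ⟨i, hi⟩
    have := congrArg (fun z => ((z i : barSub 𝔽 (B.toList.get i) t) : 𝔽)) hxy
    simpa [hg, hi] using this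
  have hπ : ∀ (x : (barcodeModule 𝔽 B).V s) (i : Fin B.toList.length),
      (((barcodeModule 𝔽 B).π s t hst x i : barSub 𝔽 (B.toList.get i) t) : 𝔽) =
        if Bar.has (B.toList.get i) t then ((x i : barSub 𝔽 (B.toList.get i) s) : 𝔽) else 0 :=
    fun _ _ => rfl
  have hrange : LinearMap.range ((barcodeModule 𝔽 B).π s t hst) = LinearMap.range g := by
    apply le_antisymm
    · rintro _ ⟨x, rfl⟩
      refine ⟨fun i => ((x i.1 : barSub 𝔽 (B.toList.get i.1) s) : 𝔽), ?_⟩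
      funext i
      apply Subtype.ext
      rw [hg]
      refine Eq.trans ?_ (hπ x i).symm
      by_cases h : P i
      · rw [dif_pos h, if_pos (hP i h).2]
      · rw [dif_neg h]
        split_ifs with ht
        · exact (barSub_coe_zero (fun hs => h ((Bar.has_and_has_iff hst).1 ⟨hs, ht⟩)) _).symm
        · rfl
    · rintro _ ⟨x, rfl⟩
      refine ⟨fun i => if h : P i then ⟨x ⟨i, h⟩, mem_barSub (hP i h).1 _⟩ else 0, ?_⟩
      funext i
      apply Subtype.ext
      rw [hg]
      refine (hπ _ i).trans ?_
      by_cases h : P i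
      · rw [if_pos (hP i h).2, dif_pos h, dif_pos h]
      · simp [h]
  rw [hrange]
  refine (LinearMap.finrank_range_of_inj hinj).trans ?_
  rw [Module.finrank_fintype_fun_eq_card]
  conv_rhs => rw [← Multiset.coe_toList B, Multiset.coe_countP]
  rw [← List.card_subtype_get_eq_countP]

open Filter Topology in
/-- Just to the right of `a`, no first endpoint of a bar of `B` occurs. -/
lemma eventually_fst_lt_iff (B : Multiset Bar) (a : ℝ) :
    ∀ᶠ s in 𝓝[>] a, ∀ I ∈ B, I.1 < s ↔ I.1 ≤ a := by
  have key : ∀ I ∈ B.toFinset, ∀ᶠ s in 𝓝[>] a, I.1 < s ↔ I.1 ≤ a := by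
    intro I _
    by_cases h : I.1 ≤ a
    · filter_upwards [self_mem_nhdsWithin] with s hs
      exact iff_of_true (h.trans_lt hs) h
    · filter_upwards [mem_nhdsWithin_of_mem_nhds (Iio_mem_nhds (not_le.1 h))] with s hs
      exact iff_of_false hs.not_gt h
  simpa using (Filter.eventually_all_finset _).2 key

open Filter Topology in
/-- Just to the right of `b`, no second endpoint of a bar of `B` occurs. -/
lemma eventually_le_snd_iff (B : Multiset Bar) (b : ℝ) :
    ∀ᶠ t in 𝓝[>] b, ∀ I ∈ B, ((t : ℝ) : EReal) ≤ I.2 ↔ (b : EReal) < I.2 := by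
  have key : ∀ I ∈ B.toFinset, ∀ᶠ t in 𝓝[>] b, ((t : ℝ) : EReal) ≤ I.2 ↔ (b : EReal) < I.2 := by
    intro I _
    by_cases h : (b : EReal) < I.2
    · have hlt : ∀ᶠ t : ℝ in 𝓝 b, (t : EReal) < I.2 :=
        continuous_coe_real_ereal.continuousAt.eventually_lt continuousAt_const h
      filter_upwards [mem_nhdsWithin_of_mem_nhds hlt] with t ht
      exact iff_of_true (le_of_lt ht) h
    · filter_upwards [self_mem_nhdsWithin] with t ht
      exact iff_of_false
        (not_le.2 ((not_lt.1 h).trans_lt (EReal.coe_lt_coe_iff.2 ht))) h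
  simpa using (Filter.eventually_all_finset _).2 key

open Filter in
/-- Beyond some point, only infinite bars of `B` survive. -/
lemma eventually_le_snd_iff_eq_top (B : Multiset Bar) :
    ∀ᶠ t : ℝ in atTop, ∀ I ∈ B, (t : EReal) ≤ I.2 ↔ I.2 = ⊤ := by
  have key : ∀ I ∈ B.toFinset, ∀ᶠ t : ℝ in atTop, (t : EReal) ≤ I.2 ↔ I.2 = ⊤ := by
    intro I _
    by_cases h : I.2 = ⊤
    · simp [h]
    · filter_upwards [eventually_gt_atTop I.2.toReal] with t ht
      refine iff_of_false (not_le.2 ?_) h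
      exact (EReal.le_coe_toReal h).trans_lt (EReal.coe_lt_coe_iff.2 ht)
  simpa using (Filter.eventually_all_finset _).2 key

lemma count_add_countP_eq_of_top {B : Multiset Bar} {a s t : ℝ}
    (hs : ∀ I ∈ B, I.1 < s ↔ I.1 ≤ a) (ht : ∀ I ∈ B, (t : EReal) ≤ I.2 ↔ I.2 = ⊤) :
    B.count (a, ⊤) + B.countP (fun I : Bar => I.1 < a ∧ (t : EReal) ≤ I.2) =
      B.countP (fun I : Bar => I.1 < s ∧ (t : EReal) ≤ I.2) := by
  induction B using Multiset.induction_on with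
  | empty => simp
  | cons I B ih =>
    have ih := ih (fun J hJ => hs J (Multiset.mem_cons_of_mem hJ))
      (fun J hJ => ht J (Multiset.mem_cons_of_mem hJ))
    have h1 := hs I (Multiset.mem_cons_self I B)
    have h2 := ht I (Multiset.mem_cons_self I B)
    have h3 : (a, (⊤ : EReal)) = I ↔ a = I.1 ∧ ⊤ = I.2 := Prod.ext_iff
    simp only [Multiset.count_cons, Multiset.countP_cons, h1, h2, h3]
    rcases lt_trichotomy I.1 a with h | h | h
    · simp only [h, h.le, h.ne', true_and, false_and, if_false]
      omega
    · simp only [h, lt_irrefl, le_refl, true_and, false_and, if_false, eq_comm (a := (⊤ : EReal))]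
      omega
    · simp only [h.not_gt, h.not_ge, h.ne, false_and, if_false]
      omega

lemma count_add_countP_eq_of_coe {B : Multiset Bar} {a b s t : ℝ}
    (hs : ∀ I ∈ B, I.1 < s ↔ I.1 ≤ a) (ht : ∀ I ∈ B, (t : EReal) ≤ I.2 ↔ (b : EReal) < I.2) :
    B.count (a, (b : EReal)) + B.countP (fun I : Bar => I.1 < a ∧ (b : EReal) ≤ I.2) +
        B.countP (fun I : Bar => I.1 < s ∧ (t : EReal) ≤ I.2) =
      B.countP (fun I : Bar => I.1 < s ∧ (b : EReal) ≤ I.2) +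
        B.countP (fun I : Bar => I.1 < a ∧ (t : EReal) ≤ I.2) := by
  induction B using Multiset.induction_on with
  | empty => simp
  | cons I B ih =>
    have ih := ih (fun J hJ => hs J (Multiset.mem_cons_of_mem hJ))
      (fun J hJ => ht J (Multiset.mem_cons_of_mem hJ))
    have h1 := hs I (Multiset.mem_cons_self I B)
    have h2 := ht I (Multiset.mem_cons_self I B)
    have h3 : (a, (b : EReal)) = I ↔ a = I.1 ∧ (b : EReal) = I.2 := Prod.ext_iff
    simp only [Multiset.count_cons, Multiset.countP_cons, h1, h2, h3]
    rcases lt_trichotomy I.1 a with h | h | h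
    · simp only [h, h.le, h.ne', true_and, false_and, if_false]
      omega
    · rcases lt_trichotomy I.2 (b : EReal) with h' | h' | h'
      · simp only [h, h'.not_ge, h'.not_gt, h'.ne', lt_irrefl, and_false, if_false]
        omega
      · simp only [h, h', lt_irrefl, le_refl, and_self, and_false, false_and, if_true, if_false]
        omega
      · simp only [h, h', h'.le, h'.ne, lt_irrefl, le_refl, and_self, and_false, false_and,
          if_true, if_false]
        omega
    · simp only [h.not_gt, h.not_ge, h.ne, false_and, if_false]
      omega

open Filter Topology in
/-- A barcode is determined by the numbers of bars containing each pair of points. -/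
lemma eq_of_countP_eq {B C : Multiset Bar}
    (hB : ∀ I ∈ B, Bar.valid I) (hC : ∀ I ∈ C, Bar.valid I)
    (h : ∀ s t : ℝ, s ≤ t → B.countP (fun I : Bar => I.1 < s ∧ (t : EReal) ≤ I.2) =
      C.countP (fun I : Bar => I.1 < s ∧ (t : EReal) ≤ I.2)) :
    B = C := by
  ext ⟨a, b⟩
  by_cases hab : Bar.valid (a, b)
  swap
  · rw [Multiset.count_eq_zero_of_notMem fun hI => hab (hB _ hI),
      Multiset.count_eq_zero_of_notMem fun hI => hab (hC _ hI)]
  induction b with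
  | bot => simp [Bar.valid] at hab
  | top =>
    obtain ⟨s, ⟨hsB, hsC⟩, has⟩ := ((eventually_fst_lt_iff B a).and
      (eventually_fst_lt_iff C a)|>.and self_mem_nhdsWithin).exists
    obtain ⟨t, ⟨htB, htC⟩, hst⟩ := ((eventually_le_snd_iff_eq_top B).and
      (eventually_le_snd_iff_eq_top C)|>.and (eventually_ge_atTop s)).exists
    have has : a < s := has
    have e1 := count_add_countP_eq_of_top hsB htB
    have e2 := count_add_countP_eq_of_top hsC htC
    rw [h a t (has.le.trans hst), h s t hst] at e1
    omega
  | coe b =>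
    have hab : a < b := EReal.coe_lt_coe_iff.1 hab
    obtain ⟨s, ⟨hsB, hsC⟩, has, hsb⟩ := ((eventually_fst_lt_iff B a).and
      (eventually_fst_lt_iff C a)|>.and (Ioo_mem_nhdsGT hab)).exists
    obtain ⟨t, ⟨htB, htC⟩, hbt⟩ := ((eventually_le_snd_iff B b).and
      (eventually_le_snd_iff C b)|>.and self_mem_nhdsWithin).exists
    have hbt : b < t := hbt
    have e1 := count_add_countP_eq_of_coe hsB htB
    have e2 := count_add_countP_eq_of_coe hsC htC
    rw [h a b hab.le, h s t (hsb.trans hbt).le, h s b hsb.le, h a t (hab.trans hbt).le] at e1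
    omega

/-- **Normal Form Theorem (uniqueness).** If the direct sums of the interval modules of
two finite multisets of intervals are isomorphic persistence modules, then the multisets
coincide. -/
theorem normal_form_uniqueness {𝔽 : Type} [Field 𝔽] (B C : Multiset Bar)
    (hB : ∀ I ∈ B, Bar.valid I) (hC : ∀ I ∈ C, Bar.valid I)
    (h : PersistenceModule.Iso (barcodeModule 𝔽 B) (barcodeModule 𝔽 C)) :
    B = C := by
  refine eq_of_countP_eq hB hC fun s t hst => ?_
  rw [← finrank_range_barcodeModule 𝔽 B hst, ← finrank_range_barcodeModule 𝔽 C hst]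
  exact h.finrank_range_eq hst
end

section
/- If there exists a δ-matching between the barcodes of two persistence modules V and W (i.e., between finite multisets B and C of intervals with V ≅ ⊕_{I∈B} 𝔽(I) and W ≅ ⊕_{J∈C} 𝔽(J)), then V and W are δ-interleaved. In particular, d_int(V,W) ≤ d_bot(B,C). -/
open Classical

namespace PersistenceModule

variable {𝔽 : Type} [Field 𝔽]

/-- Interleavings can be transported along isomorphisms of persistence modules. -/
lemma Interleaved.of_iso {M M' N N' : PersistenceModule 𝔽} {δ : ℝ} (hM : Iso M M')
    (hN : Iso N N') (h : Interleaved M' N' δ) : Interleaved M N δ := by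
  obtain ⟨f, f', hf'f, hff'⟩ := hM
  obtain ⟨g, g', hg'g, hgg'⟩ := hN
  obtain ⟨F, G, hF, hG, hGF, hFG⟩ := h
  refine ⟨fun t => (g'.A (t + δ)).comp ((F t).comp (f.A t)),
    fun t => (f'.A (t + δ)).comp ((G t).comp (g.A t)), fun s t hst => ?_, fun s t hst => ?_,
    fun t ht => ?_, fun t ht => ?_⟩
  · ext x
    have h₁ := LinearMap.congr_fun (f.comm s t hst) x
    have h₂ := LinearMap.congr_fun (hF s t hst) (f.A s x)
    have h₃ := LinearMap.congr_fun (g'.comm (s + δ) (t + δ) (by linarith)) (F s (f.A s x))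
    simp only [LinearMap.comp_apply] at *
    rw [h₁, h₂, h₃]
  · ext x
    have h₁ := LinearMap.congr_fun (g.comm s t hst) x
    have h₂ := LinearMap.congr_fun (hG s t hst) (g.A s x)
    have h₃ := LinearMap.congr_fun (f'.comm (s + δ) (t + δ) (by linarith)) (G s (g.A s x))
    simp only [LinearMap.comp_apply] at *
    rw [h₁, h₂, h₃]
  · ext x
    have h₁ := LinearMap.congr_fun (hGF t ht) (f.A t x)
    have h₂ := LinearMap.congr_fun (f'.comm t _ ht) (f.A t x)
    simp only [LinearMap.comp_apply] at *
    rw [hgg', h₁, h₂, hf'f]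
  · ext x
    have h₁ := LinearMap.congr_fun (hFG t ht) (g.A t x)
    have h₂ := LinearMap.congr_fun (g'.comm t _ ht) (g.A t x)
    simp only [LinearMap.comp_apply] at *
    rw [hff', h₁, h₂, hg'g]

end PersistenceModule

lemma BarClose.symm {δ : ℝ} {I J : Bar} (h : BarClose δ I J) : BarClose δ J I := by
  obtain ⟨h₁, h₂⟩ := h
  refine ⟨by rwa [abs_sub_comm], h₂.imp And.symm fun h => ⟨h.2.1, h.1, ?_⟩⟩
  rw [abs_sub_comm]
  exact h.2.2

/-- The right endpoints of `δ`-close bars: a time at distance `δ` before the end of one bar is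
not past the end of the other. -/
lemma BarClose.le_right {δ t : ℝ} {I J : Bar} (h : BarClose δ I J) (hJ : Bar.valid J)
    (ht : ((t + δ : ℝ) : EReal) ≤ I.2) : (t : EReal) ≤ J.2 := by
  obtain ⟨-, ⟨-, hJt⟩ | ⟨hI, hJt, hd⟩⟩ := h
  · simp [hJt]
  · have hIb : I.2 ≠ ⊥ := ne_bot_of_le_ne_bot (EReal.coe_ne_bot _) ht
    have hJb : J.2 ≠ ⊥ := ne_bot_of_gt hJ
    rw [← EReal.coe_toReal hI hIb, EReal.coe_le_coe_iff] at ht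
    rw [← EReal.coe_toReal hJt hJb, EReal.coe_le_coe_iff]
    linarith [(abs_le.mp hd).2]

lemma BarClose.left_lt {δ t : ℝ} {I J : Bar} (h : BarClose δ I J) (ht : I.1 < t) :
    J.1 < t + δ := by
  linarith [(abs_le.mp h.1).1]

/-- A bar containing both `t` and `t + δ + δ` is longer than `2δ`. -/
lemma barLong_of_has {δ t : ℝ} {I : Bar} (h₁ : Bar.has I t) (h₂ : Bar.has I (t + δ + δ)) :
    BarLong δ I := by
  obtain ⟨h₁, -⟩ := h₁
  obtain ⟨-, h₂⟩ := h₂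
  obtain ⟨a, b⟩ := I
  unfold BarLong
  induction b with
  | bot => simp at h₂
  | top => exact (EReal.coe_lt_top _).trans_eq (EReal.top_sub_coe a).symm
  | coe b =>
    simp only [EReal.coe_le_coe_iff] at h₁ h₂ ⊢
    rw [← EReal.coe_sub, EReal.coe_lt_coe_iff]
    linarith

/-- The map from the fiber at `s` of the interval module of `I` to the fiber at `t` of the
interval module of `J` which is the identity of `𝔽` when both fibers are nonzero. -/
noncomputable def barTransfer (𝔽 : Type) [Field 𝔽] (I J : Bar) (s t : ℝ) :
    barSub 𝔽 I s →ₗ[𝔽] barSub 𝔽 J t where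
  toFun x := ⟨if Bar.has J t then (x : 𝔽) else 0, by
    split_ifs with hm
    · simp [barSub, hm]
    · exact (barSub 𝔽 J t).zero_mem⟩
  map_add' x y := by
    apply Subtype.ext
    by_cases hm : Bar.has J t <;> simp [hm]
  map_smul' c x := by
    apply Subtype.ext
    by_cases hm : Bar.has J t <;> simp [hm]

lemma barTransfer_coe (𝔽 : Type) [Field 𝔽] (I J : Bar) (s t : ℝ) (x : barSub 𝔽 I s) :
    (barTransfer 𝔽 I J s t x : 𝔽) = if Bar.has J t then (x : 𝔽) else 0 := rfl

/-- The maps `barTransfer` between `δ`-close bars form a morphism to the `δ`-shift. -/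
lemma barTransfer_barMap {𝔽 : Type} [Field 𝔽] {I J : Bar} {δ s t : ℝ} (h : BarClose δ I J)
    (hI : Bar.valid I) (hst : s ≤ t) (x : barSub 𝔽 I s) :
    barTransfer 𝔽 I J t (t + δ) (barMap 𝔽 I s t x) =
      barMap 𝔽 J (s + δ) (t + δ) (barTransfer 𝔽 I J s (s + δ) x) := by
  apply Subtype.ext
  simp only [barTransfer_coe, barMap_coe]
  by_cases hJ : Bar.has J (t + δ)
  · by_cases hs : Bar.has I s
    · have hIt : Bar.has I t := ⟨hs.1.trans_le hst, h.symm.le_right hI hJ.2⟩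
      have hJs : Bar.has J (s + δ) :=
        ⟨h.left_lt hs.1, le_trans (by exact_mod_cast add_le_add_left hst δ) hJ.2⟩
      simp [hIt, hJs]
    · simp [barSub_coe_zero hs x]
  · simp [hJ]

/-- The maps `barTransfer` between `δ`-close bars compose to the `2δ`-shift. -/
lemma barTransfer_barTransfer {𝔽 : Type} [Field 𝔽] {I J : Bar} {δ t : ℝ} (h : BarClose δ I J)
    (hJ : Bar.valid J) (x : barSub 𝔽 I t) :
    barTransfer 𝔽 J I (t + δ) (t + δ + δ) (barTransfer 𝔽 I J t (t + δ) x) =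
      barMap 𝔽 I t (t + δ + δ) x := by
  apply Subtype.ext
  simp only [barTransfer_coe, barMap_coe]
  by_cases hI : Bar.has I (t + δ + δ)
  · by_cases ht : Bar.has I t
    · have hJt : Bar.has J (t + δ) := ⟨h.left_lt ht.1, h.le_right hJ hI.2⟩
      simp [hJt]
    · simp [barSub_coe_zero ht x]
  · simp [hI]

/-- The `2δ`-shift of a bar of length at most `2δ` vanishes. -/
lemma barMap_eq_zero_of_not_barLong {𝔽 : Type} [Field 𝔽] {I : Bar} {δ t : ℝ}
    (h : ¬ BarLong δ I) (x : barSub 𝔽 I t) : barMap 𝔽 I t (t + δ + δ) x = 0 := by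
  apply Subtype.ext
  rw [barMap_coe]
  split_ifs with h₂
  · exact barSub_coe_zero (fun h₁ => h (barLong_of_has h₁ h₂)) x
  · rfl

/-- The map of barcode modules induced by a partial matching `σ` of the bars. -/
noncomputable def barcodeTransfer (𝔽 : Type) [Field 𝔽] {B C : Multiset Bar}
    (σ : Fin B.toList.length ≃. Fin C.toList.length) (s t : ℝ) :
    (barcodeModule 𝔽 B).V s →ₗ[𝔽] (barcodeModule 𝔽 C).V t :=
  LinearMap.pi fun j => (σ.symm j).elim 0 fun i =>
    (barTransfer 𝔽 (B.toList.get i) (C.toList.get j) s t).comp (LinearMap.proj i)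

section barcodeTransfer

variable {𝔽 : Type} [Field 𝔽] {B C : Multiset Bar}
  {σ : Fin B.toList.length ≃. Fin C.toList.length}

lemma barcodeTransfer_apply_of_none {s t : ℝ} {j : Fin C.toList.length} (h : σ.symm j = none)
    (x : (barcodeModule 𝔽 B).V s) : barcodeTransfer 𝔽 σ s t x j = 0 := by
  change ((σ.symm j).elim 0 _ : (barcodeModule 𝔽 B).V s →ₗ[𝔽] _) x = 0
  rw [h]
  rfl

lemma barcodeTransfer_apply_of_some {s t : ℝ} {i : Fin B.toList.length}
    {j : Fin C.toList.length} (h : σ.symm j = some i) (x : (barcodeModule 𝔽 B).V s) :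
    barcodeTransfer 𝔽 σ s t x j =
      barTransfer 𝔽 (B.toList.get i) (C.toList.get j) s t (x i) := by
  change ((σ.symm j).elim 0 _ : (barcodeModule 𝔽 B).V s →ₗ[𝔽] _) x = _
  rw [h]
  rfl

lemma barcodeModule_π_apply {s t : ℝ} (h : s ≤ t) (x : (barcodeModule 𝔽 B).V s)
    (i : Fin B.toList.length) :
    (barcodeModule 𝔽 B).π s t h x i = barMap 𝔽 (B.toList.get i) s t (x i) := rfl

lemma barcodeTransfer_comp_π {δ : ℝ}
    (hB : ∀ I ∈ B, Bar.valid I)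
    (hσ : ∀ i j, σ i = some j → BarClose δ (B.toList.get i) (C.toList.get j))
    (s t : ℝ) (hst : s ≤ t) :
    (barcodeTransfer 𝔽 σ t (t + δ)).comp ((barcodeModule 𝔽 B).π s t hst) =
      ((barcodeModule 𝔽 C).π (s + δ) (t + δ) (by linarith)).comp
        (barcodeTransfer 𝔽 σ s (s + δ)) := by
  refine LinearMap.ext fun x => funext fun j => ?_
  rw [LinearMap.comp_apply, LinearMap.comp_apply, barcodeModule_π_apply]
  cases h : σ.symm j with
  | none => rw [barcodeTransfer_apply_of_none h, barcodeTransfer_apply_of_none h, map_zero]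
  | some i =>
    rw [barcodeTransfer_apply_of_some h, barcodeTransfer_apply_of_some h, barcodeModule_π_apply]
    exact barTransfer_barMap (hσ i j (σ.eq_some_iff.mp h))
      (hB _ (Multiset.mem_toList.mp (List.get_mem _ i))) hst _

lemma barcodeTransfer_symm_comp_barcodeTransfer {δ : ℝ}
    (hC : ∀ I ∈ C, Bar.valid I)
    (hσ : ∀ i j, σ i = some j → BarClose δ (B.toList.get i) (C.toList.get j))
    (hlong : ∀ i, BarLong δ (B.toList.get i) → σ i ≠ none)
    (t : ℝ) (ht : t ≤ t + δ + δ) :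
    (barcodeTransfer 𝔽 σ.symm (t + δ) (t + δ + δ)).comp (barcodeTransfer 𝔽 σ t (t + δ)) =
      (barcodeModule 𝔽 B).π t (t + δ + δ) ht := by
  refine LinearMap.ext fun x => funext fun i => ?_
  rw [LinearMap.comp_apply, barcodeModule_π_apply]
  cases h : σ i with
  | none =>
    rw [barcodeTransfer_apply_of_none (by rwa [PEquiv.symm_symm]),
      barMap_eq_zero_of_not_barLong fun hl => hlong i hl h]
  | some j =>
    rw [barcodeTransfer_apply_of_some (by rwa [PEquiv.symm_symm]),
      barcodeTransfer_apply_of_some (σ.eq_some_iff.mpr h)]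
    exact barTransfer_barTransfer (hσ i j h) (hC _ (Multiset.mem_toList.mp (List.get_mem _ j))) _

/-- A partial matching of the bars, matching all long bars and only `δ`-close ones, induces a
`δ`-interleaving of the barcode modules. -/
lemma interleaved_barcodeModule {δ : ℝ}
    (hB : ∀ I ∈ B, Bar.valid I) (hC : ∀ I ∈ C, Bar.valid I)
    (hσ : ∀ i j, σ i = some j → BarClose δ (B.toList.get i) (C.toList.get j))
    (hlongB : ∀ i, BarLong δ (B.toList.get i) → σ i ≠ none)
    (hlongC : ∀ j, BarLong δ (C.toList.get j) → σ.symm j ≠ none) :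
    PersistenceModule.Interleaved (barcodeModule 𝔽 B) (barcodeModule 𝔽 C) δ := by
  have hσ' : ∀ j i, σ.symm j = some i → BarClose δ (C.toList.get j) (B.toList.get i) :=
    fun j i h => (hσ i j (σ.eq_some_iff.mp h)).symm
  exact ⟨fun t => barcodeTransfer 𝔽 σ t (t + δ), fun t => barcodeTransfer 𝔽 σ.symm t (t + δ),
    barcodeTransfer_comp_π hB hσ, barcodeTransfer_comp_π hC hσ',
    barcodeTransfer_symm_comp_barcodeTransfer hC hσ hlongB,
    barcodeTransfer_symm_comp_barcodeTransfer (σ := σ.symm) hB hσ' hlongC⟩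

end barcodeTransfer

/-- The number of indices of a list whose entries satisfy `p`, counted in the multiset of the
entries. -/
lemma card_filter_get {α : Type} (l : List α) (p : α → Prop) :
    (Finset.univ.filter fun i : Fin l.length => p (l.get i)).card =
      (cfilter p (l : Multiset α)).card := by
  have h : (l : Multiset α) = Finset.univ.val.map l.get := by
    rw [Fin.univ_val_map, List.ofFn_get]
  conv_rhs => rw [h]
  unfold cfilter
  rw [Multiset.filter_map, Multiset.card_map]
  rfl

/-- If the image of a list `l` under `f` is a sub-multiset of `B` containing all elements
satisfying `p`, it is realized by an injection of index sets whose range contains all indices of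
elements satisfying `p`. -/
lemma exists_injective_index {α β : Type} (l : List α) (f : α → β) (B : Multiset β)
    (p : β → Prop) (hle : Multiset.map f l ≤ B) (hp : cfilter p B ≤ Multiset.map f l) :
    ∃ u : Fin l.length → Fin B.toList.length, Function.Injective u ∧
      (∀ k, B.toList.get (u k) = f (l.get k)) ∧ ∀ i, p (B.toList.get i) → ∃ k, u k = i := by
  have hsub : (l.map f).Subperm B.toList := by
    rw [← Multiset.coe_le, Multiset.coe_toList, ← Multiset.map_coe]
    exact hle
  have hu : ∃ u : Fin l.length → Fin B.toList.length, Function.Injective u ∧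
      ∀ k, B.toList.get (u k) = f (l.get k) := by
    refine ⟨fun k => hsub.idxInj (k.cast (List.length_map f).symm), ?_, fun k => ?_⟩
    · exact hsub.idxInj_injective.comp (Fin.cast_injective _)
    · simp
  obtain ⟨u, hinj, hget⟩ := hu
  refine ⟨u, hinj, hget, fun i hi => ?_⟩
  have hcard : (Finset.univ.filter fun i => p (B.toList.get i)).card ≤
      (Finset.univ.filter fun k => p (f (l.get k))).card := by
    rw [card_filter_get, card_filter_get l fun a => p (f a), Multiset.coe_toList]
    have h := Multiset.filter_le_filter p hp
    have h' := Multiset.card_le_card h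
    unfold cfilter at h' ⊢
    rw [Multiset.filter_map, Multiset.card_map] at h'
    rw [Multiset.filter_filter] at h'
    simp only [and_self] at h'
    exact h'
  have hmaps : (Finset.univ.filter fun k => p (f (l.get k))).image u ⊆
      Finset.univ.filter fun i => p (B.toList.get i) := by
    intro j hj
    obtain ⟨k, hk, rfl⟩ := Finset.mem_image.mp hj
    simpa only [Finset.mem_filter, Finset.mem_univ, true_and, hget] using hk
  have heq := Finset.eq_of_subset_of_card_le hmaps
    (by rwa [Finset.card_image_of_injective _ hinj])
  have hmem : i ∈ (Finset.univ.filter fun k => p (f (l.get k))).image u := by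
    rw [heq]
    simpa using hi
  obtain ⟨k, -, hk⟩ := Finset.mem_image.mp hmem
  exact ⟨k, hk⟩

/-- An injective function, as a partial equivalence. -/
noncomputable def PEquiv.ofInjective {α β : Type} (u : α → β) (hu : Function.Injective u) :
    α ≃. β where
  toFun a := some (u a)
  invFun := Function.partialInv u
  inv a b := by
    exact (hu.isPartialInv a b).trans Option.some_inj.symm

/-- A `δ`-matching, as a partial equivalence between the index sets of the bars. -/
lemma IsMatching.exists_pequiv {δ : ℝ} {B C : Multiset Bar} {m : Multiset (Bar × Bar)}
    (h : IsMatching δ B C m) :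
    ∃ σ : Fin B.toList.length ≃. Fin C.toList.length,
      (∀ i j, σ i = some j → BarClose δ (B.toList.get i) (C.toList.get j)) ∧
      (∀ i, BarLong δ (B.toList.get i) → σ i ≠ none) ∧
      ∀ j, BarLong δ (C.toList.get j) → σ.symm j ≠ none := by
  obtain ⟨hB, hC, hlongB, hlongC, hclose⟩ := h
  rw [← Multiset.coe_toList m] at hB hC hlongB hlongC
  obtain ⟨u, hu, hget, hlong⟩ := exists_injective_index m.toList Prod.fst B _ hB hlongB
  obtain ⟨v, hv, hget', hlong'⟩ := exists_injective_index m.toList Prod.snd C _ hC hlongC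
  have hσ : ∀ i j, ((PEquiv.ofInjective u hu).symm.trans (PEquiv.ofInjective v hv)) i = some j ↔
      ∃ k, u k = i ∧ v k = j := by
    intro i j
    simp only [PEquiv.trans_eq_some, PEquiv.eq_some_iff]
    simp [PEquiv.ofInjective]
  refine ⟨(PEquiv.ofInjective u hu).symm.trans (PEquiv.ofInjective v hv), fun i j hij => ?_,
    fun i hi hn => ?_, fun j hj hn => ?_⟩
  · obtain ⟨k, rfl, rfl⟩ := (hσ i j).mp hij
    rw [hget, hget']
    exact hclose _ (Multiset.mem_toList.mp (List.get_mem _ k))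
  · obtain ⟨k, rfl⟩ := hlong i hi
    simp [(hσ _ _).mpr ⟨k, rfl, rfl⟩] at hn
  · obtain ⟨k, rfl⟩ := hlong' j hj
    rw [(PEquiv.eq_some_iff _).mpr ((hσ _ _).mpr ⟨k, rfl, rfl⟩)] at hn
    cases hn

/-- If there exists a `δ`-matching between the barcodes of two persistence modules `M`
and `N`, then `M` and `N` are `δ`-interleaved; in particular
`d_int(M,N) ≤ d_bot(B,C)`. -/
theorem matching_implies_interleaving {𝔽 : Type} [Field 𝔽]
    (M N : PersistenceModule 𝔽) (hM : M.IsRegular) (hN : N.IsRegular)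
    (B C : Multiset Bar) (hB : ∀ I ∈ B, Bar.valid I) (hC : ∀ I ∈ C, Bar.valid I)
    (hMB : PersistenceModule.Iso M (barcodeModule 𝔽 B))
    (hNC : PersistenceModule.Iso N (barcodeModule 𝔽 C)) :
    (∀ δ : ℝ, 0 < δ → (∃ m, IsMatching δ B C m) → PersistenceModule.Interleaved M N δ) ∧
    PersistenceModule.dInt M N ≤ dBot B C := by
  have key : ∀ δ : ℝ, 0 < δ → (∃ m, IsMatching δ B C m) → M.Interleaved N δ := by
    rintro δ - ⟨m, hm⟩
    obtain ⟨σ, hσ, hlongB, hlongC⟩ := hm.exists_pequiv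
    exact .of_iso hMB hNC (interleaved_barcodeModule hB hC hσ hlongB hlongC)
  refine ⟨key, sInf_le_sInf ?_⟩
  rintro x ⟨δ, hδ, rfl, hm⟩
  exact ⟨δ, hδ, rfl, key δ hδ hm⟩
end
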